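/- Let (W,ψ) be a nondegenerate ternary quadratic space over an algebraic number field F (or a nonarchimedean local field) and N an integral g-lattice in W. If the order A⁺(N) is a maximal order in the quaternion algebra A⁺(W), then N is a g-maximal lattice in W with respect to ψ. -/

import Mathlib

noncomputable section

namespace Paper

variable (R F : Type*) [CommRing R] [Field F] [Algebra R F]

section Lattices

variable (W : Type*) [AddCommGroup W] [Module F W] [Module R W] [IsScalarTower R F W]

/-- A `g`-lattice in `W`: a finitely generated `R`-submodule containing an `F`-basis. -/
def IsLat (L : Submodule R W) : Prop :=
  L.FG ∧ Submodule.span F (L : Set W) = ⊤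

/-- integral lattice with respect to a bilinear form -/
def IsIntegralLat (ψ : LinearMap.BilinForm F W) (L : Submodule R W) : Prop :=
  IsLat R F W L ∧ ∀ x ∈ L, ψ x x ∈ (algebraMap R F).range

/-- maximal lattice with respect to a bilinear form -/
def IsMaximalLat (ψ : LinearMap.BilinForm F W) (L : Submodule R W) : Prop :=
  IsIntegralLat R F W ψ L ∧ ∀ L' : Submodule R W, IsIntegralLat R F W ψ L' → L ≤ L' → L' = L

/-- the ideal `[L/M]` generated by determinants of `F`-automorphisms carrying `L` into `M` -/
def latIdx (L M : Submodule R W) : Submodule R F :=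
  Submodule.span R {d : F | ∃ α : W ≃ₗ[F] W, (∀ x ∈ L, α x ∈ M) ∧
    LinearMap.det (α : W →ₗ[F] W) = d}

/-- the dual lattice `L~ = {x | 2ψ(x,L) ⊆ g}` -/
def dualLat (ψ : LinearMap.BilinForm F W) (L : Submodule R W) : Submodule R W :=
  ⨅ y ∈ L, Submodule.comap (((2 : F) • (ψ.flip y)).restrictScalars R)
    (LinearMap.range (Algebra.linearMap R F))

/-- the ideal `[L/M]` for lattices spanning the subspace `U`, computed inside `U` -/
def latIdxIn (U : Submodule F W) (L M : Submodule R W) : Submodule R F :=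
  latIdx R F ↥U (Submodule.comap ((U.subtype).restrictScalars R) L)
    (Submodule.comap ((U.subtype).restrictScalars R) M)

/-- product of a fractional ideal and a lattice -/
def idSMul {M : Type*} [AddCommGroup M] [Module F M] [Module R M] [IsScalarTower R F M]
    (I : Submodule R F) (N : Submodule R M) : Submodule R M :=
  Submodule.span R {z : M | ∃ c ∈ I, ∃ x ∈ N, z = c • x}

end Lattices

/-- the fractional ideal attached to an integral ideal -/
def idealToF (I : Ideal R) : Submodule R F :=
  Submodule.map (Algebra.linearMap R F) I

section Clifford

variable (W : Type*) [AddCommGroup W] [Module F W] [Module R W] [IsScalarTower R F W]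
variable (Q : QuadraticForm F W)

/-- the order `A(N)` generated by `g` and `N` in the Clifford algebra -/
def cliffordOrder (N : Submodule R W) : Subalgebra R (CliffordAlgebra Q) :=
  Algebra.adjoin R (CliffordAlgebra.ι Q '' (N : Set W))

/-- the even Clifford algebra, as an `R`-subalgebra -/
def evenR : Subalgebra R (CliffordAlgebra Q) :=
  (CliffordAlgebra.even Q).restrictScalars R

/-- `A⁺(N) = A⁺(W) ∩ A(N)` -/
def APlus (N : Submodule R W) : Subalgebra R (CliffordAlgebra Q) :=
  evenR R F W Q ⊓ cliffordOrder R F W Q N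

def APlusSub (N : Submodule R W) : Submodule R (CliffordAlgebra Q) :=
  Subalgebra.toSubmodule (APlus R F W Q N)

def oneLat : Submodule R (CliffordAlgebra Q) :=
  LinearMap.range (Algebra.linearMap R (CliffordAlgebra Q))

/-- the `R`-linear map `x ↦ 2ν(x,y) = x·y* + y·x*`, where `*` is the canonical
involution (reversal) of the Clifford algebra -/
def traceMap (y : CliffordAlgebra Q) : CliffordAlgebra Q →ₗ[R] CliffordAlgebra Q :=
  ((LinearMap.mulRight F (CliffordAlgebra.reverse (Q := Q) y)) +
    (LinearMap.mulLeft F y) ∘ₗ (CliffordAlgebra.reverse (Q := Q))).restrictScalars R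

/-- the dual `o~ = {x ∈ A⁺(W) | 2ν(x,o) ⊆ g}` with respect to the norm form
`ν[x] = x x*` of the even Clifford algebra -/
def normDual (o : Submodule R (CliffordAlgebra Q)) : Submodule R (CliffordAlgebra Q) :=
  Subalgebra.toSubmodule (evenR R F W Q) ⊓
    ⨅ y ∈ o, Submodule.comap (traceMap R F W Q y) (oneLat R F W Q)

/-- `A⁺(W)° = {x ∈ A⁺(W) | x* = -x}`, as an `R`-submodule -/
def minusPart : Submodule R (CliffordAlgebra Q) :=
  Subalgebra.toSubmodule (evenR R F W Q) ⊓
    LinearMap.ker ((CliffordAlgebra.reverse (Q := Q) + LinearMap.id).restrictScalars R)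

end Clifford

end Paper

namespace Paper

section Orders

variable (R F : Type*) [CommRing R] [Field F] [Algebra R F]
variable (A : Type*) [Ring A] [Algebra F A] [Algebra R A] [IsScalarTower R F A]

/-- an order in the `F`-subalgebra `B` of `A`: an `R`-subalgebra which is an `R`-lattice
in `B` -/
def IsOrderIn (B : Subalgebra F A) (o : Subalgebra R A) : Prop :=
  (Subalgebra.toSubmodule o).FG ∧ (o : Set A) ⊆ (B : Set A) ∧
    Submodule.span F (o : Set A) = Subalgebra.toSubmodule B

/-- a maximal order in `B` -/
def IsMaximalOrderIn (B : Subalgebra F A) (o : Subalgebra R A) : Prop :=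
  IsOrderIn R F A B o ∧ ∀ o' : Subalgebra R A, IsOrderIn R F A B o' → o ≤ o' → o' = o

end Orders

section Abbrev

variable (R F : Type*) [CommRing R] [Field F] [Algebra R F]
variable (W : Type*) [AddCommGroup W] [Module F W] [Module R W] [IsScalarTower R F W]
variable (psi : LinearMap.BilinForm F W)

/-- the ideal `[A⁺(M)/A⁺(N)]`, computed inside the quaternion algebra `A⁺(W)` -/
def APlusIdx (M N : Submodule R W) : Submodule R F :=
  latIdxIn R F (CliffordAlgebra (LinearMap.BilinMap.toQuadraticMap psi))
    (Subalgebra.toSubmodule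
      (CliffordAlgebra.even (LinearMap.BilinMap.toQuadraticMap psi)))
    (APlusSub R F W (LinearMap.BilinMap.toQuadraticMap psi) M)
    (APlusSub R F W (LinearMap.BilinMap.toQuadraticMap psi) N)

/-- the ideal `[A⁺(N)~/A⁺(N)]`, computed inside the quaternion algebra `A⁺(W)` -/
def APlusDualIdx (N : Submodule R W) : Submodule R F :=
  latIdxIn R F (CliffordAlgebra (LinearMap.BilinMap.toQuadraticMap psi))
    (Subalgebra.toSubmodule
      (CliffordAlgebra.even (LinearMap.BilinMap.toQuadraticMap psi)))
    (normDual R F W (LinearMap.BilinMap.toQuadraticMap psi)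
      (APlusSub R F W (LinearMap.BilinMap.toQuadraticMap psi) N))
    (APlusSub R F W (LinearMap.BilinMap.toQuadraticMap psi) N)

/-- the fractional ideal `2⁻¹·[Ñ/N]` -/
def halfDualIdx (N : Submodule R W) : Submodule R F :=
  Submodule.span R {((2 : F)⁻¹)} * latIdx R F W (dualLat R F W psi N) N

end Abbrev

end Paper

namespace Paper

section OrderGenerators

variable {R A : Type*} [CommRing R] [Ring A] [Algebra R A]

/-- The subalgebra generated by finitely many elements whose squares and anticommutators are
scalars is a finitely generated module. -/
theorem fg_adjoin_of_clifford_relations (X : Set A)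
    (hsq : ∀ x ∈ X, ∃ r : R, x * x = algebraMap R A r)
    (hanti : ∀ x ∈ X, ∀ y ∈ X, ∃ r : R, x * y + y * x = algebraMap R A r)
    (hfin : X.Finite) : (Subalgebra.toSubmodule (Algebra.adjoin R X)).FG := by
  induction X, hfin using Set.Finite.induction_on with
  | empty =>
    rw [Algebra.adjoin_empty, Algebra.toSubmodule_bot]
    rw [Submodule.one_eq_span]
    exact Submodule.fg_span_singleton 1
  | @insert x X hx hfin ih =>
    have ih := ih (fun y hy => hsq y (Set.mem_insert_of_mem _ hy))
      (fun y hy z hz => hanti y (Set.mem_insert_of_mem _ hy) z (Set.mem_insert_of_mem _ hz))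
    set M := Subalgebra.toSubmodule (Algebra.adjoin R X) with hM
    set S : Submodule R A := M ⊔ M.map (LinearMap.mulLeft R x) with hS
    suffices h : Subalgebra.toSubmodule (Algebra.adjoin R (insert x X)) = S by
      rw [h]
      exact ih.sup (ih.map _)
    have mem_S : ∀ z, z ∈ S ↔ ∃ a ∈ Algebra.adjoin R X, ∃ b ∈ Algebra.adjoin R X,
        a + x * b = z := by
      intro z
      simp [hS, hM, Submodule.mem_sup]
    apply le_antisymm
    · have key : ∀ z ∈ Algebra.adjoin R (insert x X), ∀ w ∈ S, z * w ∈ S := by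
        intro z hz
        induction hz using Algebra.adjoin_induction with
        | mem y hy =>
          intro w hw
          obtain ⟨a, ha, b, hb, rfl⟩ := (mem_S w).1 hw
          rw [mem_S]
          rcases Set.mem_insert_iff.1 hy with rfl | hy'
          · obtain ⟨r, hr⟩ := hsq y hy
            refine ⟨algebraMap R A r * b, mul_mem (algebraMap_mem _ _) hb, a, ha, ?_⟩
            rw [← hr]
            noncomm_ring
          · obtain ⟨r, hr⟩ := hanti y hy x (Set.mem_insert _ _)
            have hyX := Algebra.subset_adjoin (R := R) hy'
            refine ⟨y * a + algebraMap R A r * b,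
              add_mem (mul_mem hyX ha) (mul_mem (algebraMap_mem _ _) hb),
              -(y * b), neg_mem (mul_mem hyX hb), ?_⟩
            rw [← hr]
            noncomm_ring
        | algebraMap r =>
          intro w hw
          rw [← Algebra.smul_def]
          exact S.smul_mem r hw
        | add y z _ _ hy hz =>
          intro w hw
          rw [add_mul]
          exact S.add_mem (hy w hw) (hz w hw)
        | mul y z _ _ hy hz =>
          intro w hw
          rw [mul_assoc]
          exact hy _ (hz w hw)
      intro z hz
      have := key z hz 1 ((mem_S 1).2 ⟨1, one_mem _, 0, zero_mem _, by simp⟩)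
      simpa using this
    · intro z hz
      obtain ⟨a, ha, b, hb, rfl⟩ := (mem_S z).1 hz
      have hle : Algebra.adjoin R X ≤ Algebra.adjoin R (insert x X) :=
        Algebra.adjoin_mono (Set.subset_insert _ _)
      exact Subalgebra.add_mem _ (hle ha)
        (Subalgebra.mul_mem _ (Algebra.subset_adjoin (Set.mem_insert _ _)) (hle hb))

/-- The span of the ordered products of three elements. -/
def orderedProducts (R : Type*) {A : Type*} [CommRing R] [Ring A] [Algebra R A] (a b c : A) :
    Submodule R A :=
  Submodule.span R {1, a, b, c, a * b, a * c, b * c, a * (b * c)}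

theorem one_mem_orderedProducts (a b c : A) : (1 : A) ∈ orderedProducts R a b c :=
  Submodule.subset_span (by simp)

theorem mul_mem_orderedProducts {a b c : A} {qa qb qc tab tac tbc : R}
    (ha : a * a = algebraMap R A qa) (hb : b * b = algebraMap R A qb)
    (hc : c * c = algebraMap R A qc) (hab : a * b + b * a = algebraMap R A tab)
    (hac : a * c + c * a = algebraMap R A tac) (hbc : b * c + c * b = algebraMap R A tbc)
    (r₁ r₂ r₃ : R) {w : A} (hw : w ∈ orderedProducts R a b c) :
    (r₁ • a + r₂ • b + r₃ • c) * w ∈ orderedProducts R a b c := by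
  set S := orderedProducts R a b c with hS
  have m1 : (1 : A) ∈ S := Submodule.subset_span (by simp)
  have ma : a ∈ S := Submodule.subset_span (by simp)
  have mb : b ∈ S := Submodule.subset_span (by simp)
  have mc : c ∈ S := Submodule.subset_span (by simp)
  have mab : a * b ∈ S := Submodule.subset_span (by simp)
  have mac : a * c ∈ S := Submodule.subset_span (by simp)
  have mbc : b * c ∈ S := Submodule.subset_span (by simp)
  have mabc : a * (b * c) ∈ S := Submodule.subset_span (by simp)
  have hba' : b * a = tab • (1 : A) - a * b := by
    rw [← Algebra.algebraMap_eq_smul_one, ← hab]; noncomm_ring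
  have hca' : c * a = tac • (1 : A) - a * c := by
    rw [← Algebra.algebraMap_eq_smul_one, ← hac]; noncomm_ring
  have hcb' : c * b = tbc • (1 : A) - b * c := by
    rw [← Algebra.algebraMap_eq_smul_one, ← hbc]; noncomm_ring
  rw [Algebra.algebraMap_eq_smul_one] at ha hb hc
  have ha2 : ∀ z, a * (a * z) = qa • z := fun z => by rw [← mul_assoc, ha, smul_one_mul]
  have hb2 : ∀ z, b * (b * z) = qb • z := fun z => by rw [← mul_assoc, hb, smul_one_mul]
  have hba2 : ∀ z, b * (a * z) = tab • z - a * (b * z) := fun z => by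
    rw [← mul_assoc, hba', sub_mul, smul_one_mul, mul_assoc]
  have hca2 : ∀ z, c * (a * z) = tac • z - a * (c * z) := fun z => by
    rw [← mul_assoc, hca', sub_mul, smul_one_mul, mul_assoc]
  have hcb2 : ∀ z, c * (b * z) = tbc • z - b * (c * z) := fun z => by
    rw [← mul_assoc, hcb', sub_mul, smul_one_mul, mul_assoc]
  have hgen : ∀ x ∈ ({a, b, c} : Set A), ∀ w ∈ S, x * w ∈ S := by
    intro x hx w hw
    induction hw using Submodule.span_induction with
    | zero => simp
    | add y z _ _ hy hz => rw [mul_add]; exact S.add_mem hy hz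
    | smul r y _ hy => rw [mul_smul_comm]; exact S.smul_mem r hy
    | mem w hw =>
      simp only [Set.mem_insert_iff, Set.mem_singleton_iff] at hx hw
      rcases hx with rfl | rfl | rfl <;>
      rcases hw with rfl | rfl | rfl | rfl | rfl | rfl | rfl | rfl <;>
      (try simp only [mul_one, ha, hb, hc, ha2, hb2, hba', hca', hcb', hba2, hca2, hcb2, mul_sub,
        mul_smul_comm]) <;>
      repeat' first
        | assumption
        | apply S.sub_mem
        | apply S.smul_mem
  rw [add_mul, add_mul, smul_mul_assoc, smul_mul_assoc, smul_mul_assoc]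
  exact S.add_mem (S.add_mem (S.smul_mem _ (hgen a (by simp) w hw))
    (S.smul_mem _ (hgen b (by simp) w hw))) (S.smul_mem _ (hgen c (by simp) w hw))

/-- If `s • X` lies in the span of `a, b, c`, then every element of the algebra generated by `X`
is carried by a power of `s` into the span of the ordered products of `a, b, c`. -/
theorem exists_pow_smul_mem_orderedProducts {a b c : A} {qa qb qc tab tac tbc : R}
    (ha : a * a = algebraMap R A qa) (hb : b * b = algebraMap R A qb)
    (hc : c * c = algebraMap R A qc) (hab : a * b + b * a = algebraMap R A tab)
    (hac : a * c + c * a = algebraMap R A tac) (hbc : b * c + c * b = algebraMap R A tbc)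
    {X : Set A} {s : R}
    (hX : ∀ x ∈ X, ∃ r₁ r₂ r₃ : R, s • x = r₁ • a + r₂ • b + r₃ • c)
    {z : A} (hz : z ∈ Algebra.adjoin R X) : ∃ k : ℕ, s ^ k • z ∈ orderedProducts R a b c := by
  set S := orderedProducts R a b c with hS
  suffices h : ∃ k : ℕ, ∀ w ∈ S, s ^ k • (z * w) ∈ S by
    obtain ⟨k, hk⟩ := h
    exact ⟨k, by simpa using hk 1 (one_mem_orderedProducts a b c)⟩
  induction hz using Algebra.adjoin_induction with
  | mem x hx =>
    obtain ⟨r₁, r₂, r₃, h⟩ := hX x hx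
    refine ⟨1, fun w hw => ?_⟩
    rw [pow_one, ← smul_mul_assoc, h]
    exact mul_mem_orderedProducts ha hb hc hab hac hbc _ _ _ hw
  | algebraMap r =>
    refine ⟨0, fun w hw => ?_⟩
    rw [pow_zero, one_smul, ← Algebra.smul_def]
    exact S.smul_mem r hw
  | add y z _ _ hy hz =>
    obtain ⟨k, hk⟩ := hy
    obtain ⟨l, hl⟩ := hz
    refine ⟨k + l, fun w hw => ?_⟩
    rw [add_mul, smul_add]
    refine S.add_mem ?_ ?_
    · rw [add_comm, pow_add, mul_smul]
      exact S.smul_mem _ (hk w hw)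
    · rw [pow_add, mul_smul]
      exact S.smul_mem _ (hl w hw)
  | mul y z _ _ hy hz =>
    obtain ⟨k, hk⟩ := hy
    obtain ⟨l, hl⟩ := hz
    refine ⟨k + l, fun w hw => ?_⟩
    have := hk _ (hl w hw)
    rwa [mul_smul_comm, smul_smul, ← pow_add, ← mul_assoc] at this

end OrderGenerators

section TripleProduct

open Matrix

variable {K : Type*} [CommRing K]

/-- The scalar triple product. -/
def triple (x y z : Fin 3 → K) : K := x ⬝ᵥ (crossProduct y z)

theorem triple_eq (x y z : Fin 3 → K) : triple x y z =
    x 0 * (y 1 * z 2 - y 2 * z 1) + x 1 * (y 2 * z 0 - y 0 * z 2)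
      + x 2 * (y 0 * z 1 - y 1 * z 0) := by
  simp [triple, cross_apply, dotProduct, Fin.sum_univ_three]

theorem triple_smul_eq (e₁ e₂ e₃ x : Fin 3 → K) :
    triple e₁ e₂ e₃ • x =
      triple x e₂ e₃ • e₁ + triple e₁ x e₃ • e₂ + triple e₁ e₂ x • e₃ := by
  ext i
  fin_cases i <;> simp [triple_eq] <;> ring

theorem triple_cross (a b c : Fin 3 → K) :
    triple (crossProduct a b) (crossProduct a c) (crossProduct b c) = triple a b c ^ 2 := by
  simp only [triple_eq, cross_apply]
  simp
  ring

theorem triple_smul_smul_smul (r s t : K) (x y z : Fin 3 → K) :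
    triple (r • x) (s • y) (t • z) = r * s * t * triple x y z := by
  simp only [triple_eq, Pi.smul_apply, smul_eq_mul]
  ring

theorem triple_combination (a b c r₁ r₂ r₃ : Fin 3 → K) :
    triple (r₁ 0 • a + r₁ 1 • b + r₁ 2 • c) (r₂ 0 • a + r₂ 1 • b + r₂ 2 • c)
      (r₃ 0 • a + r₃ 1 • b + r₃ 2 • c) = triple r₁ r₂ r₃ * triple a b c := by
  simp only [triple_eq, Pi.add_apply, Pi.smul_apply, smul_eq_mul]
  ring

end TripleProduct

section Dedekind

variable {R F : Type*} [CommRing R] [IsDedekindDomain R] [Field F] [Algebra R F]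
  [IsFractionRing R F]

open scoped nonZeroDivisors

/-- A finitely generated nonzero fractional ideal is, away from a given maximal ideal, generated by
one of any given set of generators. -/
theorem exists_local_generator (G : Set F) (hfg : (Submodule.span R G).FG)
    (hne : ∃ g ∈ G, g ≠ 0) (P : Ideal R) (hP : P.IsMaximal) :
    ∃ d ∈ G, d ≠ 0 ∧ ∃ s ∉ P, ∀ g ∈ G, ∃ r : R, algebraMap R F s * g = algebraMap R F r * d := by
  let I : FractionalIdeal R⁰ F := ⟨Submodule.span R G, FractionalIdeal.isFractional_of_fg hfg⟩
  have hGI : ∀ g ∈ G, g ∈ I := fun g hg => Submodule.subset_span hg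
  have hI : I ≠ 0 := by
    obtain ⟨g, hg, hg0⟩ := hne
    intro h
    have := hGI g hg
    rw [h, FractionalIdeal.mem_zero_iff] at this
    exact hg0 this
  have hII : I * I⁻¹ = 1 := mul_inv_cancel₀ hI
  have hint : ∀ g ∈ I, ∀ y ∈ I⁻¹, ∃ r : R, algebraMap R F r = g * y := by
    intro g hg y hy
    have := FractionalIdeal.mul_mem_mul hg hy
    rw [hII] at this
    exact (FractionalIdeal.mem_one_iff _).1 this
  obtain ⟨d, hd, y, hy, s, hs, hsP⟩ :
      ∃ d ∈ G, ∃ y ∈ I⁻¹, ∃ s : R, algebraMap R F s = d * y ∧ s ∉ P := by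
    by_contra! hcon
    have hle : I * I⁻¹ ≤ (P : FractionalIdeal R⁰ F) := by
      rw [FractionalIdeal.mul_le]
      intro i hi j hj
      have hi' : i ∈ Submodule.span R G := hi
      induction hi' using Submodule.span_induction with
      | zero => rw [zero_mul]; exact Submodule.zero_mem (P : FractionalIdeal R⁰ F).coeToSubmodule
      | mem g hg =>
        obtain ⟨r, hr⟩ := hint g (hGI g hg) j hj
        rw [FractionalIdeal.mem_coeIdeal]
        exact ⟨r, hcon g hg j hj r hr, hr⟩
      | add a b ha hb iha ihb =>
        rw [add_mul]
        exact Submodule.add_mem (P : FractionalIdeal R⁰ F).coeToSubmodule (iha ha) (ihb hb)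
      | smul r a ha iha =>
        rw [smul_mul_assoc]
        exact Submodule.smul_mem (P : FractionalIdeal R⁰ F).coeToSubmodule r (iha ha)
    rw [hII] at hle
    have h1 := hle (FractionalIdeal.one_mem_one R⁰)
    obtain ⟨r, hr, hr1⟩ := (FractionalIdeal.mem_coeIdeal R⁰).1 h1
    have : r = 1 := IsFractionRing.injective R F (by rw [hr1, map_one])
    exact hP.ne_top (P.eq_top_iff_one.2 (this ▸ hr))
  refine ⟨d, hd, ?_, s, hsP, fun g hg => ?_⟩
  · rintro rfl
    rw [zero_mul] at hs
    have : s = 0 := IsFractionRing.injective R F (by rw [hs, map_zero])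
    exact hsP (this ▸ P.zero_mem)
  · obtain ⟨r, hr⟩ := hint g (hGI g hg) y hy
    exact ⟨r, by rw [hs, hr]; ring⟩

theorem exists_pow_mul_eq_algebraMap_mul {d t : F} (hd : d ≠ 0) {s r : R} {k : ℕ}
    (h : algebraMap R F s ^ k * t ^ 2 = algebraMap R F r * d ^ 2) :
    ∃ q : R, algebraMap R F s ^ k * t = algebraMap R F q * d := by
  obtain ⟨q, hq⟩ := IsIntegrallyClosed.exists_algebraMap_eq_of_isIntegral_pow (R := R) (K := F)
    (x := algebraMap R F s ^ k * t / d) (n := 2) two_pos (by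
      have : (algebraMap R F s ^ k * t / d) ^ 2 = algebraMap R F (s ^ k * r) := by
        rw [map_mul, map_pow]
        field_simp
        linear_combination algebraMap R F s ^ k * h
      rw [this]
      exact isIntegral_algebraMap)
  exact ⟨q, by rw [hq]; field_simp⟩

end Dedekind

section Lattice

open Matrix

variable {R F : Type*} [CommRing R] [IsDedekindDomain R] [Field F] [Algebra R F]
  [IsFractionRing R F]
variable {W : Type*} [AddCommGroup W] [Module F W] [Module R W] [IsScalarTower R F W]

omit [IsFractionRing R F] in
theorem fg_span_triple (φ : W →ₗ[F] Fin 3 → F) {N : Submodule R W} (hN : N.FG) :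
    (Submodule.span R {t : F | ∃ x ∈ N, ∃ y ∈ N, ∃ z ∈ N, triple (φ x) (φ y) (φ z) = t}).FG := by
  have hN' : (N.map (φ.restrictScalars R)).FG := hN.map _
  refine Submodule.FG.of_le (hN'.map₂ ((dotProductBilin F F).restrictScalars₁₂ R R)
    (hN'.map₂ ((crossProduct (R := F)).restrictScalars₁₂ R R) hN')) (Submodule.span_le.2 ?_)
  rintro _ ⟨x, hx, y, hy, z, hz, rfl⟩
  exact Submodule.apply_mem_map₂ _ (Submodule.mem_map_of_mem hx)
    (Submodule.apply_mem_map₂ _ (Submodule.mem_map_of_mem hy) (Submodule.mem_map_of_mem hz))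

omit [IsDedekindDomain R] [Algebra R F] [IsFractionRing R F] [IsScalarTower R F W] in
theorem exists_triple_ne_zero (φ : W ≃ₗ[F] Fin 3 → F) {N : Submodule R W}
    (hN : Submodule.span F (N : Set W) = ⊤) :
    ∃ x ∈ N, ∃ y ∈ N, ∃ z ∈ N, triple (φ x) (φ y) (φ z) ≠ 0 := by
  by_contra! h
  have h1 : ∀ x ∈ N, ∀ y ∈ N, ∀ z, triple (φ x) (φ y) (φ z) = 0 := by
    intro x hx y hy z
    have hz : z ∈ Submodule.span F (N : Set W) := hN ▸ Submodule.mem_top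
    induction hz using Submodule.span_induction with
    | mem z hz => exact h x hx y hy z hz
    | zero => simp [triple]
    | add a b _ _ ha hb => simp only [triple, map_add, dotProduct_add] at *; simp [ha, hb]
    | smul r a _ ha => simp only [triple, map_smul, dotProduct_smul] at *; simp [ha]
  have h2 : ∀ x ∈ N, ∀ y z, triple (φ x) (φ y) (φ z) = 0 := by
    intro x hx y z
    have hy : y ∈ Submodule.span F (N : Set W) := hN ▸ Submodule.mem_top
    induction hy using Submodule.span_induction with
    | mem y hy => exact h1 x hx y hy z
    | zero => simp [triple]
    | add a b _ _ ha hb =>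
      simp only [triple, map_add, LinearMap.add_apply, dotProduct_add] at *; simp [ha, hb]
    | smul r a _ ha =>
      simp only [triple, map_smul, LinearMap.smul_apply, dotProduct_smul] at *; simp [ha]
  have h3 : ∀ x y z, triple (φ x) (φ y) (φ z) = 0 := by
    intro x y z
    have hx : x ∈ Submodule.span F (N : Set W) := hN ▸ Submodule.mem_top
    induction hx using Submodule.span_induction with
    | mem x hx => exact h2 x hx y z
    | zero => simp [triple]
    | add a b _ _ ha hb => simp only [triple, map_add, add_dotProduct] at *; simp [ha, hb]
    | smul r a _ ha => simp only [triple, map_smul, smul_dotProduct] at *; simp [ha]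
  have := h3 (φ.symm ![1, 0, 0]) (φ.symm ![0, 1, 0]) (φ.symm ![0, 0, 1])
  simp [triple_eq] at this

omit [IsDedekindDomain R] [IsFractionRing R F] in
/-- Cramer's rule with scalars in a subring. -/
theorem smul_eq_of_triple_eq (φ : W ≃ₗ[F] Fin 3 → F) {e₁ e₂ e₃ x : W}
    (hd : triple (φ e₁) (φ e₂) (φ e₃) ≠ 0) {s r₁ r₂ r₃ : R}
    (h₁ : algebraMap R F s * triple (φ x) (φ e₂) (φ e₃) =
      algebraMap R F r₁ * triple (φ e₁) (φ e₂) (φ e₃))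
    (h₂ : algebraMap R F s * triple (φ e₁) (φ x) (φ e₃) =
      algebraMap R F r₂ * triple (φ e₁) (φ e₂) (φ e₃))
    (h₃ : algebraMap R F s * triple (φ e₁) (φ e₂) (φ x) =
      algebraMap R F r₃ * triple (φ e₁) (φ e₂) (φ e₃)) :
    s • x = r₁ • e₁ + r₂ • e₂ + r₃ • e₃ := by
  apply φ.injective
  apply smul_right_injective _ hd
  rw [← algebraMap_smul F s, ← algebraMap_smul F r₁, ← algebraMap_smul F r₂,
    ← algebraMap_smul F r₃]
  simp only [map_add, map_smul]
  rw [smul_comm, triple_smul_eq, smul_add, smul_add, smul_smul, smul_smul, smul_smul, h₁, h₂, h₃]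
  module

/-- Away from a given maximal ideal, a lattice is spanned by three of its elements. -/
theorem exists_local_basis (φ : W ≃ₗ[F] Fin 3 → F) {N : Submodule R W} (hN : IsLat R F W N)
    (P : Ideal R) (hP : P.IsMaximal) :
    ∃ e₁ ∈ N, ∃ e₂ ∈ N, ∃ e₃ ∈ N, triple (φ e₁) (φ e₂) (φ e₃) ≠ 0 ∧ ∃ s ∉ P,
      ∀ n ∈ N, ∃ r₁ r₂ r₃ : R, s • n = r₁ • e₁ + r₂ • e₂ + r₃ • e₃ := by
  obtain ⟨_, ⟨e₁, h₁, e₂, h₂, e₃, h₃, rfl⟩, hd, s, hs, hgen⟩ :=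
    exists_local_generator _ (fg_span_triple (φ : W →ₗ[F] Fin 3 → F) hN.1)
      (by
        obtain ⟨x, hx, y, hy, z, hz, h⟩ := exists_triple_ne_zero φ hN.2
        exact ⟨_, ⟨x, hx, y, hy, z, hz, rfl⟩, h⟩) P hP
  refine ⟨e₁, h₁, e₂, h₂, e₃, h₃, hd, s, hs, fun n hn => ?_⟩
  obtain ⟨r₁, hr₁⟩ := hgen _ ⟨n, hn, e₂, h₂, e₃, h₃, rfl⟩
  obtain ⟨r₂, hr₂⟩ := hgen _ ⟨e₁, h₁, n, hn, e₃, h₃, rfl⟩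
  obtain ⟨r₃, hr₃⟩ := hgen _ ⟨e₁, h₁, e₂, h₂, n, hn, rfl⟩
  exact ⟨r₁, r₂, r₃, smul_eq_of_triple_eq φ hd hr₁ hr₂ hr₃⟩

end Lattice

section CliffordBivector

variable {F : Type*} [Field F] {W : Type*} [AddCommGroup W] [Module F W]

/-- The cross product, transported along a linear map, as an alternating map. -/
def crossAlternating (φ : W →ₗ[F] Fin 3 → F) : W [⋀^Fin 2]→ₗ[F] (Fin 3 → F) where
  toFun v := crossProduct (φ (v 0)) (φ (v 1))
  map_update_add' v i x y := by
    fin_cases i <;> simp [Function.update]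
  map_update_smul' v i c x := by
    fin_cases i <;> simp [Function.update]
  map_eq_zero_of_eq' v i j h hij := by
    fin_cases i <;> fin_cases j <;> simp_all [cross_self]

/-- The bivector part of an element of the Clifford algebra of a ternary space, expressed through
the cross product. -/
theorem exists_bivector_map (ψ : LinearMap.BilinForm F W) (φ : W →ₗ[F] Fin 3 → F) :
    ∃ Φ : CliffordAlgebra (LinearMap.BilinMap.toQuadraticMap ψ) →ₗ[F] (Fin 3 → F),
      Φ 1 = 0 ∧ (∀ x, Φ (CliffordAlgebra.ι _ x) = 0) ∧
      (∀ x y, Φ (CliffordAlgebra.ι _ x * CliffordAlgebra.ι _ y) = crossProduct (φ x) (φ y)) ∧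
      ∀ x y z, Φ (CliffordAlgebra.ι _ x *
        (CliffordAlgebra.ι _ y * CliffordAlgebra.ι _ z)) = 0 := by
  have h : LinearMap.BilinMap.toQuadraticMap (-ψ) =
      0 - LinearMap.BilinMap.toQuadraticMap ψ := by
    ext x; simp
  let f : (i : ℕ) → W [⋀^Fin i]→ₗ[F] (Fin 3 → F) := fun
    | 2 => crossAlternating φ
    | _ => 0
  have f0 : f 0 = 0 := rfl
  have f1 : f 1 = 0 := rfl
  let L : CliffordAlgebra (0 : QuadraticForm F W) →ₗ[F] (Fin 3 → F) :=
    ExteriorAlgebra.liftAlternating f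
  have L1 : L 1 = 0 := by
    change ExteriorAlgebra.liftAlternating f 1 = 0
    rw [ExteriorAlgebra.liftAlternating_one, f0]; rfl
  have Lι : ∀ x, L (CliffordAlgebra.ι _ x) = 0 := by
    intro x
    change ExteriorAlgebra.liftAlternating f (ExteriorAlgebra.ι F x) = 0
    rw [ExteriorAlgebra.liftAlternating_ι, f1]; rfl
  have Lιι : ∀ x y, L (CliffordAlgebra.ι _ x * CliffordAlgebra.ι _ y) =
      crossProduct (φ x) (φ y) := by
    intro x y
    change ExteriorAlgebra.liftAlternating f (ExteriorAlgebra.ι F x * ExteriorAlgebra.ι F y) = _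
    rw [ExteriorAlgebra.liftAlternating_ι_mul, ExteriorAlgebra.liftAlternating_ι]
    rfl
  have Lιιι : ∀ x y z, L (CliffordAlgebra.ι _ x *
      (CliffordAlgebra.ι _ y * CliffordAlgebra.ι _ z)) = 0 := by
    intro x y z
    change ExteriorAlgebra.liftAlternating f (ExteriorAlgebra.ι F x *
      (ExteriorAlgebra.ι F y * ExteriorAlgebra.ι F z)) = _
    rw [ExteriorAlgebra.liftAlternating_ι_mul, ExteriorAlgebra.liftAlternating_ι_mul,
      ExteriorAlgebra.liftAlternating_ι]
    rfl
  refine ⟨L ∘ₗ CliffordAlgebra.changeForm h, ?_, ?_, ?_, ?_⟩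
  · simp [L1]
  · simp [Lι]
  · intro x y
    simp [CliffordAlgebra.changeForm_ι_mul_ι, Lιι, Algebra.algebraMap_eq_smul_one, L1]
  · intro x y z
    simp [CliffordAlgebra.changeForm_ι_mul, Lιιι, Algebra.algebraMap_eq_smul_one, Lι, mul_add,
      CliffordAlgebra.contractLeft_ι_mul]

end CliffordBivector

section Comparison

variable {R F : Type*} [CommRing R] [Field F] [Algebra R F]
variable {W : Type*} [AddCommGroup W] [Module F W] [Module R W] [IsScalarTower R F W]
variable {ψ : LinearMap.BilinForm F W}

theorem exists_ι_mul_self {L : Submodule R W} (hL : IsIntegralLat R F W ψ L) {x : W}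
    (hx : x ∈ L) : ∃ r : R,
      CliffordAlgebra.ι (LinearMap.BilinMap.toQuadraticMap ψ) x * CliffordAlgebra.ι _ x =
        algebraMap R _ r := by
  obtain ⟨r, hr⟩ := hL.2 x hx
  refine ⟨r, ?_⟩
  rw [CliffordAlgebra.ι_sq_scalar, LinearMap.BilinMap.toQuadraticMap_apply, ← hr,
    ← IsScalarTower.algebraMap_apply]

theorem exists_ι_mul_add_swap {L : Submodule R W} (hL : IsIntegralLat R F W ψ L) {x y : W}
    (hx : x ∈ L) (hy : y ∈ L) : ∃ r : R,
      CliffordAlgebra.ι (LinearMap.BilinMap.toQuadraticMap ψ) x * CliffordAlgebra.ι _ y +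
        CliffordAlgebra.ι _ y * CliffordAlgebra.ι _ x = algebraMap R _ r := by
  obtain ⟨r, hr⟩ := hL.2 x hx
  obtain ⟨s, hs⟩ := hL.2 y hy
  obtain ⟨t, ht⟩ := hL.2 (x + y) (L.add_mem hx hy)
  refine ⟨t - r - s, ?_⟩
  rw [CliffordAlgebra.ι_mul_ι_add_swap, QuadraticMap.polar,
    LinearMap.BilinMap.toQuadraticMap_apply, LinearMap.BilinMap.toQuadraticMap_apply,
    LinearMap.BilinMap.toQuadraticMap_apply, ← hr, ← hs, ← ht, ← map_sub, ← map_sub,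
    ← IsScalarTower.algebraMap_apply]

theorem fg_cliffordOrder {L : Submodule R W} (hL : IsIntegralLat R F W ψ L) :
    (Subalgebra.toSubmodule
      (cliffordOrder R F W (LinearMap.BilinMap.toQuadraticMap ψ) L)).FG := by
  obtain ⟨X, hX⟩ := hL.1.1
  have hXL : ∀ x ∈ X, x ∈ L := fun x hx => hX ▸ Submodule.subset_span hx
  have : cliffordOrder R F W (LinearMap.BilinMap.toQuadraticMap ψ) L =
      Algebra.adjoin R (CliffordAlgebra.ι (LinearMap.BilinMap.toQuadraticMap ψ) ''
        (X : Set W)) := by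
    have himage : CliffordAlgebra.ι (LinearMap.BilinMap.toQuadraticMap ψ) '' (L : Set W) =
        Submodule.span R (CliffordAlgebra.ι (LinearMap.BilinMap.toQuadraticMap ψ) ''
          (X : Set W)) := by
      rw [← hX]
      exact congrArg SetLike.coe (Submodule.map_span
        ((CliffordAlgebra.ι (LinearMap.BilinMap.toQuadraticMap ψ)).restrictScalars R) (X : Set W))
    rw [cliffordOrder, himage, Algebra.adjoin_span]
  rw [this]
  refine fg_adjoin_of_clifford_relations _ ?_ ?_ (X.finite_toSet.image _)
  · rintro _ ⟨x, hx, rfl⟩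
    exact exists_ι_mul_self hL (hXL x hx)
  · rintro _ ⟨x, hx, rfl⟩ _ ⟨y, hy, rfl⟩
    exact exists_ι_mul_add_swap hL (hXL x hx) (hXL y hy)

theorem ι_mul_ι_mem_APlus {L : Submodule R W} {x y : W} (hx : x ∈ L) (hy : y ∈ L) :
    CliffordAlgebra.ι (LinearMap.BilinMap.toQuadraticMap ψ) x * CliffordAlgebra.ι _ y ∈
      APlus R F W (LinearMap.BilinMap.toQuadraticMap ψ) L := by
  refine ⟨?_, mul_mem (Algebra.subset_adjoin ⟨x, hx, rfl⟩) (Algebra.subset_adjoin ⟨y, hy, rfl⟩)⟩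
  change _ ∈ Subalgebra.toSubmodule (CliffordAlgebra.even _)
  rw [CliffordAlgebra.even_toSubmodule]
  exact CliffordAlgebra.ι_mul_ι_mem_evenOdd_zero _ x y

theorem isOrderIn_APlus_of_le [IsNoetherianRing R] {N L : Submodule R W} (hNL : N ≤ L)
    (hL : IsIntegralLat R F W ψ L)
    (hN : IsOrderIn R F (CliffordAlgebra (LinearMap.BilinMap.toQuadraticMap ψ))
      (CliffordAlgebra.even (LinearMap.BilinMap.toQuadraticMap ψ))
      (APlus R F W (LinearMap.BilinMap.toQuadraticMap ψ) N)) :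
    APlus R F W (LinearMap.BilinMap.toQuadraticMap ψ) N ≤
        APlus R F W (LinearMap.BilinMap.toQuadraticMap ψ) L ∧
      IsOrderIn R F (CliffordAlgebra (LinearMap.BilinMap.toQuadraticMap ψ))
        (CliffordAlgebra.even (LinearMap.BilinMap.toQuadraticMap ψ))
        (APlus R F W (LinearMap.BilinMap.toQuadraticMap ψ) L) := by
  have hle : APlus R F W (LinearMap.BilinMap.toQuadraticMap ψ) N ≤
      APlus R F W (LinearMap.BilinMap.toQuadraticMap ψ) L :=
    inf_le_inf_left _ (Algebra.adjoin_mono (Set.image_mono hNL))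
  refine ⟨hle, (fg_cliffordOrder hL).of_le (fun z hz => hz.2), fun z hz => hz.1,
    le_antisymm (Submodule.span_le.2 fun z hz => hz.1) ?_⟩
  rw [← hN.2.2]
  exact Submodule.span_mono hle

variable [IsDedekindDomain R] [IsFractionRing R F]

/-- If all products of two vectors of `L` lie in `A(N)`, then `L` lies in `N` away from any given
maximal ideal. -/
theorem exists_smul_mem_of_mul_mem_cliffordOrder (φ : W ≃ₗ[F] Fin 3 → F) {N L : Submodule R W}
    (hN : IsIntegralLat R F W ψ N) (hNL : N ≤ L)
    (hL : ∀ x ∈ L, ∀ y ∈ L,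
      CliffordAlgebra.ι (LinearMap.BilinMap.toQuadraticMap ψ) x * CliffordAlgebra.ι _ y ∈
        cliffordOrder R F W (LinearMap.BilinMap.toQuadraticMap ψ) N)
    (P : Ideal R) (hP : P.IsMaximal) {x : W} (hx : x ∈ L) : ∃ s ∉ P, s • x ∈ N := by
  obtain ⟨e₁, h₁, e₂, h₂, e₃, h₃, hd, s, hs, hgen⟩ := exists_local_basis φ hN.1 P hP
  obtain ⟨Φ, Φ1, Φι, Φιι, Φιιι⟩ := exists_bivector_map ψ (φ : W →ₗ[F] Fin 3 → F)
  set u₁ := crossProduct (φ e₁) (φ e₂) with hu₁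
  set u₂ := crossProduct (φ e₁) (φ e₃) with hu₂
  set u₃ := crossProduct (φ e₂) (φ e₃) with hu₃
  have hcross : ∀ v ∈ L, ∀ w ∈ L, ∃ k : ℕ, ∃ r : Fin 3 → R,
      algebraMap R F s ^ k • crossProduct (φ v) (φ w) = algebraMap R F (r 0) • u₁ +
        algebraMap R F (r 1) • u₂ + algebraMap R F (r 2) • u₃ := by
    intro v hv w hw
    obtain ⟨_, q₁⟩ := exists_ι_mul_self hN h₁
    obtain ⟨_, q₂⟩ := exists_ι_mul_self hN h₂
    obtain ⟨_, q₃⟩ := exists_ι_mul_self hN h₃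
    obtain ⟨_, t₁₂⟩ := exists_ι_mul_add_swap hN h₁ h₂
    obtain ⟨_, t₁₃⟩ := exists_ι_mul_add_swap hN h₁ h₃
    obtain ⟨_, t₂₃⟩ := exists_ι_mul_add_swap hN h₂ h₃
    obtain ⟨k, hk⟩ := exists_pow_smul_mem_orderedProducts q₁ q₂ q₃ t₁₂ t₁₃ t₂₃ (s := s)
      (X := CliffordAlgebra.ι (LinearMap.BilinMap.toQuadraticMap ψ) '' (N : Set W)) (by
        rintro _ ⟨n, hn, rfl⟩
        obtain ⟨r₁, r₂, r₃, h⟩ := hgen n hn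
        refine ⟨r₁, r₂, r₃, ?_⟩
        have := congrArg
          ((CliffordAlgebra.ι (LinearMap.BilinMap.toQuadraticMap ψ)).restrictScalars R) h
        simpa only [map_add, map_smul, LinearMap.restrictScalars_apply] using this) (hL v hv w hw)
    refine ⟨k, ?_⟩
    have hspan : ∀ z ∈ orderedProducts R
        (CliffordAlgebra.ι (LinearMap.BilinMap.toQuadraticMap ψ) e₁)
        (CliffordAlgebra.ι _ e₂) (CliffordAlgebra.ι _ e₃), ∃ r : Fin 3 → R,
        Φ z = algebraMap R F (r 0) • u₁ +
          algebraMap R F (r 1) • u₂ + algebraMap R F (r 2) • u₃ := by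
      intro z hz
      induction hz using Submodule.span_induction with
      | zero => exact ⟨0, by simp⟩
      | add a b _ _ ha hb =>
        obtain ⟨p, hp⟩ := ha
        obtain ⟨q, hq⟩ := hb
        refine ⟨p + q, ?_⟩
        simp only [map_add, hp, hq, Pi.add_apply]
        module
      | smul r a _ ha =>
        obtain ⟨p, hp⟩ := ha
        refine ⟨r • p, ?_⟩
        rw [← algebraMap_smul F r a, map_smul, hp]
        simp only [Pi.smul_apply, smul_eq_mul, map_mul]
        module
      | mem z hz =>
        simp only [Set.mem_insert_iff, Set.mem_singleton_iff] at hz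
        rcases hz with rfl | rfl | rfl | rfl | rfl | rfl | rfl | rfl
        · exact ⟨0, by simp [Φ1]⟩
        · exact ⟨0, by simp [Φι]⟩
        · exact ⟨0, by simp [Φι]⟩
        · exact ⟨0, by simp [Φι]⟩
        · exact ⟨![1, 0, 0], by simp [Φιι, hu₁]⟩
        · exact ⟨![0, 1, 0], by simp [Φιι, hu₂]⟩
        · exact ⟨![0, 0, 1], by simp [Φιι, hu₃]⟩
        · exact ⟨0, by simp [Φιιι]⟩
    obtain ⟨r, hr⟩ := hspan _ hk
    refine ⟨r, ?_⟩
    rw [← hr, ← algebraMap_smul F (s ^ k), map_smul, Φιι, map_pow]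
    rfl
  have htriple : ∀ a ∈ L, ∀ b ∈ L, ∀ c ∈ L, ∃ k : ℕ, ∃ q : R,
      algebraMap R F s ^ k * triple (φ a) (φ b) (φ c) =
        algebraMap R F q * triple (φ e₁) (φ e₂) (φ e₃) := by
    intro a ha b hb c hc
    obtain ⟨k₁, r₁, hr₁⟩ := hcross a ha b hb
    obtain ⟨k₂, r₂, hr₂⟩ := hcross a ha c hc
    obtain ⟨k₃, r₃, hr₃⟩ := hcross b hb c hc
    refine ⟨k₁ + k₂ + k₃, exists_pow_mul_eq_algebraMap_mul hd (r := triple r₁ r₂ r₃) ?_⟩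
    rw [← triple_cross (φ a), ← triple_cross (φ e₁), pow_add, pow_add,
      ← triple_smul_smul_smul, hr₁, hr₂, hr₃]
    have hmap : algebraMap R F (triple r₁ r₂ r₃) =
        triple (algebraMap R F ∘ r₁) (algebraMap R F ∘ r₂) (algebraMap R F ∘ r₃) := by
      simp [triple_eq]
    rw [hmap]
    exact triple_combination u₁ u₂ u₃ (algebraMap R F ∘ r₁) (algebraMap R F ∘ r₂)
      (algebraMap R F ∘ r₃)
  obtain ⟨k₁, q₁, hq₁⟩ := htriple x hx e₂ (hNL h₂) e₃ (hNL h₃)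
  obtain ⟨k₂, q₂, hq₂⟩ := htriple e₁ (hNL h₁) x hx e₃ (hNL h₃)
  obtain ⟨k₃, q₃, hq₃⟩ := htriple e₁ (hNL h₁) e₂ (hNL h₂) x hx
  refine ⟨s ^ (k₁ + k₂ + k₃), fun h => hs (hP.isPrime.mem_of_pow_mem _ h), ?_⟩
  have : s ^ (k₁ + k₂ + k₃) • x = (s ^ (k₂ + k₃) * q₁) • e₁ + (s ^ (k₁ + k₃) * q₂) • e₂ +
      (s ^ (k₁ + k₂) * q₃) • e₃ := by
    refine smul_eq_of_triple_eq φ hd ?_ ?_ ?_ <;> simp only [map_mul, map_pow]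
    · linear_combination algebraMap R F s ^ (k₂ + k₃) * hq₁
    · linear_combination algebraMap R F s ^ (k₁ + k₃) * hq₂
    · linear_combination algebraMap R F s ^ (k₁ + k₂) * hq₃
  rw [this]
  exact N.add_mem (N.add_mem (N.smul_mem _ h₁) (N.smul_mem _ h₂)) (N.smul_mem _ h₃)

omit [IsDedekindDomain R] in
theorem mem_of_forall_maximal_exists_smul_mem {M : Type*} [AddCommGroup M] [Module R M]
    {N : Submodule R M} {x : M} (h : ∀ P : Ideal R, P.IsMaximal → ∃ s ∉ P, s • x ∈ N) :
    x ∈ N := by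
  let J : Ideal R := N.comap (LinearMap.toSpanSingleton R M x)
  have hJ : J = ⊤ := by
    by_contra hJ
    obtain ⟨P, hP, hJP⟩ := J.exists_le_maximal hJ
    obtain ⟨s, hs, hsx⟩ := h P hP
    exact hs (hJP hsx)
  have h1 : (1 : R) ∈ J := hJ ▸ Submodule.mem_top
  simpa [J] using h1

/-- An integral lattice in a ternary space whose even Clifford order is maximal is maximal. -/
theorem isMaximalLat_of_isMaximalOrderIn_APlus (φ : W ≃ₗ[F] Fin 3 → F) {N : Submodule R W}
    (hN : IsIntegralLat R F W ψ N)
    (hmax : IsMaximalOrderIn R F (CliffordAlgebra (LinearMap.BilinMap.toQuadraticMap ψ))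
      (CliffordAlgebra.even (LinearMap.BilinMap.toQuadraticMap ψ))
      (APlus R F W (LinearMap.BilinMap.toQuadraticMap ψ) N)) :
    IsMaximalLat R F W ψ N := by
  refine ⟨hN, fun L hL hNL => le_antisymm (fun x hx => ?_) hNL⟩
  obtain ⟨hle, hord⟩ := isOrderIn_APlus_of_le hNL hL hmax.1
  have heq := hmax.2 _ hord hle
  refine mem_of_forall_maximal_exists_smul_mem fun P hP =>
    exists_smul_mem_of_mul_mem_cliffordOrder φ hN hNL (fun v hv w hw => ?_) P hP hx
  have := ι_mul_ι_mem_APlus (R := R) (ψ := ψ) hv hw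
  rw [heq] at this
  exact this.2

end Comparison

end Paper

open Paper NumberField

/-- If `N` is an integral lattice in a nondegenerate ternary quadratic
space `(W,ψ)` over a number field and the order `A⁺(N)` is maximal in the quaternion
algebra `A⁺(W)`, then `N` is a maximal lattice. -/
theorem statement4
    (F : Type*) [Field F] [NumberField F]
    (W : Type*) [AddCommGroup W] [Module F W]
    [Module (RingOfIntegers F) W] [IsScalarTower (RingOfIntegers F) F W]
    (hW : Module.finrank F W = 3)
    (ψ : LinearMap.BilinForm F W) (hsymm : ψ.IsSymm)
    (hnd : LinearMap.BilinForm.Nondegenerate ψ)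
    (N : Submodule (RingOfIntegers F) W)
    (hN : IsIntegralLat (RingOfIntegers F) F W ψ N)
    (hmax : IsMaximalOrderIn (RingOfIntegers F) F
      (CliffordAlgebra (LinearMap.BilinMap.toQuadraticMap ψ))
      (CliffordAlgebra.even (LinearMap.BilinMap.toQuadraticMap ψ))
      (APlus (RingOfIntegers F) F W (LinearMap.BilinMap.toQuadraticMap ψ) N)) :
    IsMaximalLat (RingOfIntegers F) F W ψ N := by
  have : FiniteDimensional F W := Module.finite_of_finrank_pos (by omega)
  exact isMaximalLat_of_isMaximalOrderIn_APlus
    ((Module.finBasisOfFinrankEq F W hW).equivFun) hN hmax
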